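/- arXiv:1702.00875 — 3 statements merged into one kernel-verified Lean document; each statement's English description precedes it below -/
import Mathlib

section
/- Let d, m, n be positive integers and let b_1, …, b_m, c_1, …, c_m be invertible real d×d matrices such that b_i^{-1} c_i − b_j^{-1} c_j is invertible whenever i ≠ j. Let f_1, …, f_m, u_1, …, u_n, v_1, …, v_n : ℝ^d → ℂ be continuous functions satisfying ∑_{i=1}^m f_i(b_i x + c_i y) = ∑_{k=1}^n u_k(y) v_k(x) for all x, y ∈ ℝ^d. Then each f_i is a continuous exponential polynomial. -/
/-- `f : ℝ^d → ℂ` is a continuous exponential polynomial: a finite sum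
`∑ₖ pₖ(x) exp(⟨λₖ, x⟩)` with `pₖ` multivariate polynomials and `λₖ ∈ ℂ^d`. -/
def IsExpPoly {d : ℕ} (f : (Fin d → ℝ) → ℂ) : Prop :=
  ∃ (N : ℕ), 0 < N ∧ ∃ (p : Fin N → MvPolynomial (Fin d) ℂ) (lam : Fin N → Fin d → ℂ),
    ∀ x : Fin d → ℝ, f x = ∑ k, (MvPolynomial.eval (fun j => (x j : ℂ)) (p k)) *
      Complex.exp (∑ j, lam k j * (x j : ℂ))

namespace IsExpPoly

variable {d : ℕ} {f g : (Fin d → ℝ) → ℂ}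

theorem of_fintype {ι : Type*} [Fintype ι] (p : ι → MvPolynomial (Fin d) ℂ)
    (lam : ι → Fin d → ℂ)
    (h : ∀ x : Fin d → ℝ, f x = ∑ k, (MvPolynomial.eval (fun j => (x j : ℂ)) (p k)) *
      Complex.exp (∑ j, lam k j * (x j : ℂ))) : IsExpPoly f := by
  rcases isEmpty_or_nonempty ι with hι | hι
  · exact ⟨1, one_pos, 0, 0, fun x => by simp [h x]⟩
  · let e := Fintype.equivFin ι
    refine ⟨Fintype.card ι, Fintype.card_pos, p ∘ e.symm, lam ∘ e.symm, fun x => ?_⟩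
    rw [h x, ← e.symm.sum_comp]
    rfl

theorem zero : IsExpPoly (fun _ : Fin d → ℝ => 0) :=
  of_fintype (ι := Empty) 0 0 (by simp)

theorem const (a : ℂ) : IsExpPoly (fun _ : Fin d → ℝ => a) :=
  of_fintype (ι := Unit) (fun _ => MvPolynomial.C a) 0 (by simp)

theorem add (hf : IsExpPoly f) (hg : IsExpPoly g) : IsExpPoly (fun x => f x + g x) := by
  obtain ⟨N, -, p, lam, hf⟩ := hf
  obtain ⟨N', -, q, mu, hg⟩ := hg
  exact of_fintype (Sum.elim p q) (Sum.elim lam mu) fun x => by simp [hf, hg]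

theorem mul (hf : IsExpPoly f) (hg : IsExpPoly g) : IsExpPoly (fun x => f x * g x) := by
  obtain ⟨N, -, p, lam, hf⟩ := hf
  obtain ⟨N', -, q, mu, hg⟩ := hg
  refine of_fintype (fun k : Fin N × Fin N' => p k.1 * q k.2) (fun k => lam k.1 + mu k.2)
    fun x => ?_
  rw [hf, hg, Finset.sum_mul_sum, Fintype.sum_prod_type]
  refine Finset.sum_congr rfl fun k _ => Finset.sum_congr rfl fun l _ => ?_
  simp only [map_mul, Pi.add_apply, add_mul, Finset.sum_add_distrib, Complex.exp_add]
  ring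

theorem sum {ι : Type*} (s : Finset ι) {f : ι → (Fin d → ℝ) → ℂ}
    (hf : ∀ i ∈ s, IsExpPoly (f i)) : IsExpPoly (fun x => ∑ i ∈ s, f i x) := by
  classical
  induction s using Finset.induction_on with
  | empty => simpa using zero
  | insert a s ha ih =>
    simp only [Finset.sum_insert ha]
    exact (hf a (by simp)).add (ih fun i hi => hf i (by simp [hi]))

theorem pow_mul_exp (j : Fin d) (k : ℕ) (μ : ℂ) :
    IsExpPoly (fun x => (x j : ℂ) ^ k * Complex.exp (μ * (x j : ℂ))) :=
  of_fintype (ι := Unit) (fun _ => MvPolynomial.X j ^ k) (fun _ => Pi.single j μ)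
    (by simp [Pi.single_apply])

end IsExpPoly

/-- A continuous one-parameter semigroup in a Banach algebra is differentiable. -/
theorem exists_hasDerivAt_of_map_add {A : Type*} [NormedRing A] [NormedAlgebra ℝ A]
    [CompleteSpace A] {M : ℝ → A} (hM : Continuous M) (h0 : M 0 = 1)
    (hadd : ∀ s t, M (s + t) = M s * M t) : ∃ a, ∀ t, HasDerivAt M (M t * a) t := by
  let P : ℝ → A := fun t => ∫ s in (0 : ℝ)..t, M s
  have hP : ∀ t, HasDerivAt P (M t) t := fun t => hM.integral_hasStrictDerivAt 0 t |>.hasDerivAt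
  have hlim := (hP 0).tendsto_slope
  have hev : ∀ᶠ ε in nhdsWithin (0 : ℝ) {0}ᶜ, IsUnit (slope P 0 ε) := by
    refine hlim.eventually ?_
    rw [h0]
    exact Units.isOpen.mem_nhds isUnit_one
  obtain ⟨ε, hε, hε0⟩ := (hev.and self_mem_nhdsWithin).exists
  have hε0 : ε ≠ 0 := hε0
  have hunit : IsUnit (P ε) := by
    have : P ε = ε • slope P 0 ε := by
      have := sub_smul_slope P 0 ε
      simp only [sub_zero] at this
      rw [this]
      simp [P]
    rw [this]
    rw [Algebra.smul_def]
    exact ((Units.mk0 ε hε0).isUnit.map (algebraMap ℝ A)).mul hε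
  obtain ⟨U, hU⟩ := hunit
  have hMP : ∀ t, M t = (P (t + ε) - P t) * ↑U⁻¹ := by
    intro t
    rw [Units.eq_mul_inv_iff_mul_eq, hU]
    have h1 : P (t + ε) - P t = ∫ s in t..(t + ε), M s :=
      intervalIntegral.integral_interval_sub_left (hM.intervalIntegrable _ _)
        (hM.intervalIntegrable _ _)
    have h2 : (∫ s in (0 : ℝ)..ε, M (t + s)) = ∫ s in t..(t + ε), M s := by
      rw [intervalIntegral.integral_comp_add_left]; simp
    rw [h1, ← h2]
    simp only [hadd]
    exact ((ContinuousLinearMap.mul ℝ A (M t)).intervalIntegral_comp_comm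
      (hM.intervalIntegrable 0 ε)).symm
  have hdiff : DifferentiableAt ℝ M 0 := by
    have : M = fun t => (P (t + ε) - P t) * ↑U⁻¹ := funext hMP
    rw [this]
    have h1 : HasDerivAt (fun t => P (t + ε)) (M (0 + ε)) 0 :=
      HasDerivAt.comp_add_const 0 ε (hP (0 + ε))
    exact ((h1.sub (hP 0)).mul_const _).differentiableAt
  refine ⟨deriv M 0, fun t => ?_⟩
  have h1 : HasDerivAt (fun s => M (s - t)) (deriv M 0) t :=
    HasDerivAt.comp_sub_const t t (by simpa using hdiff.hasDerivAt)
  have h2 : M = fun s => M t * M (s - t) := by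
    funext s
    rw [← hadd]
    congr 1
    ring
  have h3 := h1.const_mul (M t)
  rwa [← h2] at h3

/-- Taylor's formula along a chain of successive derivatives which ends in `0`. -/
theorem eq_sum_pow_smul_of_hasDerivAt {E : Type*} [NormedAddCommGroup E] [NormedSpace ℝ E]
    (n : ℕ) {R : ℕ → ℝ → E} (hR : ∀ k t, HasDerivAt (R k) (R (k + 1) t) t)
    (hn : ∀ t, R n t = 0) (t : ℝ) :
    R 0 t = ∑ k ∈ Finset.range n, (t ^ k / (k.factorial : ℝ)) • R k 0 := by
  induction n generalizing R t with
  | zero => simpa using hn t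
  | succ n ih =>
    have ih' := ih (R := fun k => R (k + 1)) (fun k => hR (k + 1)) hn
    have hpow : ∀ (k : ℕ) (s : ℝ), HasDerivAt
        (fun s : ℝ => s ^ (k + 1) / ((k + 1).factorial : ℝ)) (s ^ k / (k.factorial : ℝ)) s := by
      intro k s
      refine ((hasDerivAt_pow (k + 1) s).div_const ((k + 1).factorial : ℝ)).congr_deriv ?_
      rw [Nat.factorial_succ]
      push_cast
      field_simp
    have hder : ∀ s, HasDerivAt (fun s => R 0 s -
        ∑ k ∈ Finset.range n, (s ^ (k + 1) / ((k + 1).factorial : ℝ)) • R (k + 1) 0) 0 s := by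
      intro s
      have := (hR 0 s).fun_sub (HasDerivAt.fun_sum (u := Finset.range n)
        fun k _ => (hpow k s).smul_const (R (k + 1) 0))
      rwa [ih' s, sub_self] at this
    have hconst := is_const_of_deriv_eq_zero (fun s => (hder s).differentiableAt)
      (fun s => (hder s).deriv) t 0
    simp only [ne_eq, Nat.add_eq_zero_iff, one_ne_zero, and_false, not_false_eq_true, zero_pow,
      zero_div, zero_smul, Finset.sum_const_zero, sub_zero] at hconst
    rw [Finset.sum_range_succ', ← hconst]
    simp

/-- The orbits of a continuous one-parameter semigroup on a finite-dimensional space are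
exponential polynomials. -/
theorem isExpPoly_one_parameter {d : ℕ} {E : Type*} [NormedAddCommGroup E] [NormedSpace ℂ E]
    [FiniteDimensional ℂ E] {M : ℝ → E →L[ℂ] E} (hM : Continuous M) (h0 : M 0 = 1)
    (hadd : ∀ s t, M (s + t) = M s * M t) (ℓ : E →ₗ[ℂ] ℂ) (v : E) (j : Fin d) :
    IsExpPoly (fun x => ℓ (M (x j) v)) := by
  have : CompleteSpace E := FiniteDimensional.complete ℂ E
  obtain ⟨a, ha⟩ := exists_hasDerivAt_of_map_add hM h0 hadd
  have hv : v ∈ ⨆ μ, Module.End.maxGenEigenspace (a : Module.End ℂ E) μ := by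
    rw [Module.End.iSup_maxGenEigenspace_eq_top]; trivial
  induction hv using Submodule.iSup_induction' with
  | zero => simpa using IsExpPoly.zero
  | add v w _ _ hv hw => simpa using hv.add hw
  | mem μ v hv =>
    obtain ⟨n, hn⟩ := (Module.End.mem_maxGenEigenspace _ _ _).1 hv
    let B : Module.End ℂ E := (a : Module.End ℂ E) - μ • 1
    let R : ℕ → ℝ → E := fun k t => Complex.exp (-μ * t) • M t ((B ^ k) v)
    have hR : ∀ k t, HasDerivAt (R k) (R (k + 1) t) t := by
      intro k t
      have h1 : HasDerivAt (fun t : ℝ => Complex.exp (-μ * t)) (Complex.exp (-μ * t) * -μ) t := by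
        have : HasDerivAt (fun t : ℝ => -μ * (t : ℂ)) (-μ) t := by
          simpa using (Complex.ofRealCLM.hasDerivAt (x := t)).const_mul (-μ)
        exact this.cexp
      have h2 : HasDerivAt (fun t => M t ((B ^ k) v)) (M t (a ((B ^ k) v))) t :=
        ((ContinuousLinearMap.apply ℂ E ((B ^ k) v)).restrictScalars ℝ).hasFDerivAt.comp_hasDerivAt
          t (ha t)
      refine (h1.smul h2).congr_deriv ?_
      simp only [R, pow_succ', Module.End.mul_apply, B, LinearMap.sub_apply,
        LinearMap.smul_apply, Module.End.one_apply, ContinuousLinearMap.coe_coe, map_sub, map_smul]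
      module
    have hT := eq_sum_pow_smul_of_hasDerivAt n hR (fun t => by simp [R, B, hn])
    have hMv : ∀ t : ℝ, M t v = ∑ k ∈ Finset.range n,
        ((t : ℂ) ^ k / (k.factorial : ℂ) * Complex.exp (μ * t)) • (B ^ k) v := by
      intro t
      have h1 : M t v = Complex.exp (μ * t) • R 0 t := by
        simp [R, smul_smul, ← Complex.exp_add]
      rw [h1, hT, Finset.smul_sum]
      refine Finset.sum_congr rfl fun k _ => ?_
      simp only [R, h0, ← Complex.coe_smul, smul_smul]
      simp [mul_comm]
    have : (fun x : Fin d → ℝ => ℓ (M (x j) v)) = fun x => ∑ k ∈ Finset.range n,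
        (ℓ ((B ^ k) v) / (k.factorial : ℂ)) * ((x j : ℂ) ^ k * Complex.exp (μ * x j)) := by
      funext x
      rw [hMv, map_sum]
      refine Finset.sum_congr rfl fun k _ => ?_
      rw [map_smul, smul_eq_mul]
      ring
    rw [this]
    exact IsExpPoly.sum _ fun k _ => (IsExpPoly.const _).mul (IsExpPoly.pow_mul_exp j k μ)

/-- The orbits of a continuous representation of `ℝ^d` on a finite-dimensional space are
exponential polynomials. -/
theorem isExpPoly_of_representation {d : ℕ} {E : Type*} [NormedAddCommGroup E] [NormedSpace ℂ E]
    [FiniteDimensional ℂ E] {M : (Fin d → ℝ) → E →L[ℂ] E} (hM : Continuous M) (h0 : M 0 = 1)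
    (hadd : ∀ s t, M (s + t) = M s * M t) (ℓ : E →ₗ[ℂ] ℂ) (v : E) :
    IsExpPoly (fun x => ℓ (M x v)) := by
  suffices H : ∀ (s : Finset (Fin d)) (ℓ : E →ₗ[ℂ] ℂ) (v : E),
      IsExpPoly (fun x => ℓ (M (∑ j ∈ s, Pi.single j (x j)) v)) by
    simpa [Finset.univ_sum_single] using H Finset.univ ℓ v
  intro s
  induction s using Finset.induction_on with
  | empty => intro ℓ v; simpa using IsExpPoly.const _
  | insert j s hj ih =>
    intro ℓ v
    let e := Module.finBasis ℂ E
    have : (fun x : Fin d → ℝ => ℓ (M (∑ i ∈ insert j s, Pi.single i (x i)) v)) =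
        fun x => ∑ i, e.coord i (M (∑ i ∈ s, Pi.single i (x i)) v) *
          ℓ (M (Pi.single j (x j)) (e i)) := by
      funext x
      rw [Finset.sum_insert hj, hadd, mul_apply_eq_comp]
      generalize M (∑ i ∈ s, Pi.single i (x i)) v = w
      conv_lhs => rw [← e.sum_repr w]
      simp only [map_sum, map_smul, smul_eq_mul, Module.Basis.coord_apply]
    rw [this]
    refine IsExpPoly.sum _ fun i _ => (ih _ _).mul
      (isExpPoly_one_parameter (M := fun t => M (Pi.single j t)) ?_ ?_ ?_ ℓ (e i) j)
    · exact hM.comp (continuous_single (A := fun _ : Fin d => ℝ) j)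
    · simpa using h0
    · intro s t
      rw [← hadd, Pi.single_add]

/-- Translation by `h`, acting on complex-valued functions. -/
def translateBy {d : ℕ} (h : Fin d → ℝ) : ((Fin d → ℝ) → ℂ) →ₗ[ℂ] ((Fin d → ℝ) → ℂ) :=
  LinearMap.funLeft ℂ ℂ (· + h)

@[simp]
theorem translateBy_apply {d : ℕ} (h : Fin d → ℝ) (f : (Fin d → ℝ) → ℂ) (x : Fin d → ℝ) :
    translateBy h f x = f (x + h) := rfl

theorem translateBy_add {d : ℕ} (h k : Fin d → ℝ) (f : (Fin d → ℝ) → ℂ) :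
    translateBy (h + k) f = translateBy h (translateBy k f) := by
  funext x
  simp [add_assoc]

@[simp]
theorem translateBy_zero {d : ℕ} (f : (Fin d → ℝ) → ℂ) : translateBy 0 f = f := by
  funext x
  simp

theorem continuous_translateBy {d : ℕ} {f : (Fin d → ℝ) → ℂ} (hf : Continuous f) :
    Continuous (fun h => translateBy h f) :=
  continuous_pi fun _ => hf.comp (continuous_const.add continuous_id)

theorem Continuous.translateBy {d : ℕ} {f : (Fin d → ℝ) → ℂ} (hf : Continuous f)
    (h : Fin d → ℝ) : Continuous (translateBy h f) :=
  hf.comp (continuous_id.add continuous_const)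

/-- `f` lies in a finite-dimensional translation-invariant space of continuous functions. -/
def IsTranslationFinite {d : ℕ} (f : (Fin d → ℝ) → ℂ) : Prop :=
  ∃ W : Submodule ℂ ((Fin d → ℝ) → ℂ), FiniteDimensional ℂ W ∧
    (∀ h, ∀ w ∈ W, translateBy h w ∈ W) ∧ (∀ w ∈ W, Continuous w) ∧ f ∈ W

theorem IsTranslationFinite.isExpPoly {d : ℕ} {f : (Fin d → ℝ) → ℂ}
    (hf : IsTranslationFinite f) : IsExpPoly f := by
  obtain ⟨W, hW, hinv, hcont, hfW⟩ := hf
  let e := (Module.finBasis ℂ W).equivFun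
  let τ : (Fin d → ℝ) → W →ₗ[ℂ] W := fun h => (translateBy h).restrict (hinv h)
  let M : (Fin d → ℝ) → (Fin (Module.finrank ℂ W) → ℂ) →L[ℂ] (Fin (Module.finrank ℂ W) → ℂ) :=
    fun h => LinearMap.toContinuousLinearMap (e.toLinearMap ∘ₗ τ h ∘ₗ e.symm.toLinearMap)
  have hM : Continuous M := by
    rw [continuous_clm_apply]
    intro v
    have h1 : Continuous e.toLinearMap := LinearMap.continuous_of_finiteDimensional _
    have h2 : Continuous (fun h => τ h (e.symm v)) :=
      (continuous_translateBy (hcont _ (e.symm v).2)).subtype_mk _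
    exact h1.comp h2
  have h0 : M 0 = 1 := by
    ext1 v
    have : τ 0 (e.symm v) = e.symm v := Subtype.ext (translateBy_zero _)
    simp [M, this]
  have hadd : ∀ s t, M (s + t) = M s * M t := by
    intro s t
    ext1 v
    have : τ (s + t) (e.symm v) = τ s (τ t (e.symm v)) := Subtype.ext (translateBy_add _ _ _)
    simp [M, this]
  let ℓ : (Fin (Module.finrank ℂ W) → ℂ) →ₗ[ℂ] ℂ :=
    LinearMap.proj (0 : Fin d → ℝ) ∘ₗ W.subtype ∘ₗ e.symm.toLinearMap
  convert isExpPoly_of_representation hM h0 hadd ℓ (e ⟨f, hfW⟩) using 2 with x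
  simp [ℓ, M, τ]

/-- A closed subgroup of `ℝ` containing `1` and `√2` is everything. -/
theorem AddSubgroup.eq_top_of_one_mem_of_sqrt_two_mem {S : AddSubgroup ℝ}
    (hS : IsClosed (S : Set ℝ)) (h1 : (1 : ℝ) ∈ S) (h2 : √2 ∈ S) : S = ⊤ := by
  have hd : Dense (AddSubgroup.closure {√2, (1 : ℝ)} : Set ℝ) := by
    rw [dense_addSubgroupClosure_pair_iff]
    simpa using irrational_sqrt_two
  have hle : AddSubgroup.closure {√2, (1 : ℝ)} ≤ S := by
    rw [AddSubgroup.closure_le]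
    rintro x (rfl | rfl)
    exacts [h2, h1]
  have := (hd.mono hle).closure_eq
  rw [hS.closure_eq] at this
  exact SetLike.coe_injective (by simpa using this)

theorem forall_translateBy_mem_of_finite_set {d : ℕ} {W : Submodule ℂ ((Fin d → ℝ) → ℂ)}
    [FiniteDimensional ℂ W] (hcont : ∀ w ∈ W, Continuous w)
    (hW : ∀ (j : Fin d), ∀ t ∈ ({1, -1, √2, -√2} : Set ℝ), ∀ w ∈ W,
      translateBy (Pi.single j t) w ∈ W) (h : Fin d → ℝ) : ∀ w ∈ W, translateBy h w ∈ W := by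
  have hclosed : ∀ w ∈ W, IsClosed {h : Fin d → ℝ | translateBy h w ∈ W} := fun w hw =>
    W.closed_of_finiteDimensional.preimage (continuous_translateBy (hcont w hw))
  let T : Fin d → AddSubgroup ℝ := fun j =>
    { carrier := {t | ∀ w ∈ W,
        translateBy (Pi.single j t) w ∈ W ∧ translateBy (Pi.single j (-t)) w ∈ W}
      zero_mem' := by intro w hw; simpa using hw
      add_mem' := by
        intro s t hs ht w hw
        rw [neg_add, Pi.single_add, Pi.single_add, translateBy_add, translateBy_add]
        exact ⟨(hs _ (ht w hw).1).1, (hs _ (ht w hw).2).2⟩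
      neg_mem' := by
        intro s hs w hw
        rw [neg_neg]
        exact (hs w hw).symm }
  have hT : ∀ j, T j = ⊤ := by
    intro j
    refine AddSubgroup.eq_top_of_one_mem_of_sqrt_two_mem ?_
      (fun w hw => ⟨hW j _ (by simp) w hw, hW j _ (by simp) w hw⟩)
      (fun w hw => ⟨hW j _ (by simp) w hw, hW j _ (by simp) w hw⟩)
    have : (T j : Set ℝ) = ⋂ w ∈ W, {t | translateBy (Pi.single j t) w ∈ W} ∩
        {t | translateBy (Pi.single j (-t)) w ∈ W} := by
      ext t
      simp [T, ← SetLike.mem_coe]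
    rw [this]
    refine isClosed_biInter fun w hw => IsClosed.inter ?_ ?_
    · exact (hclosed w hw).preimage (continuous_single j)
    · exact (hclosed w hw).preimage ((continuous_single j).comp continuous_neg)
  suffices H : ∀ s : Finset (Fin d), ∀ w ∈ W, translateBy (∑ j ∈ s, Pi.single j (h j)) w ∈ W by
    simpa [Finset.univ_sum_single] using H Finset.univ
  intro s
  induction s using Finset.induction_on with
  | empty => simp
  | insert j s hj ih =>
    intro w hw
    rw [Finset.sum_insert hj, translateBy_add]
    have : h j ∈ T j := by rw [hT]; trivial
    exact (this _ (ih w hw)).1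

theorem isTranslationFinite_of_difference {d : ℕ} {f : (Fin d → ℝ) → ℂ} (hf : Continuous f)
    (hΔ : ∀ h, IsTranslationFinite (translateBy h f - f)) : IsTranslationFinite f := by
  choose V hVfin hVinv hVcont hVmem using hΔ
  let s : Fin 4 → ℝ := ![1, -1, √2, -√2]
  let U : Submodule ℂ ((Fin d → ℝ) → ℂ) :=
    ⨆ p : Fin d × Fin 4, V (Pi.single p.1 (s p.2))
  let C : Submodule ℂ ((Fin d → ℝ) → ℂ) :=
    { carrier := {g | Continuous g}
      zero_mem' := continuous_zero
      add_mem' := fun ha hb => Continuous.add ha hb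
      smul_mem' := fun a _ hg => Continuous.const_smul hg a }
  have hUC : U ≤ C := iSup_le fun p => hVcont _
  have hUinv : ∀ h, U ≤ U.comap (translateBy h) := fun h => iSup_le fun p w hw =>
    Submodule.mem_iSup_of_mem (p := fun p : Fin d × Fin 4 => V (Pi.single p.1 (s p.2))) p
      (hVinv _ h w hw)
  let W := U ⊔ Submodule.span ℂ {f}
  have hWC : W ≤ C := sup_le hUC ((Submodule.span_singleton_le_iff_mem f C).2 hf)
  have hfW : f ∈ W := Submodule.mem_sup_right (Submodule.mem_span_singleton_self f)
  refine ⟨W, inferInstance, fun h => forall_translateBy_mem_of_finite_set hWC ?_ h, hWC, hfW⟩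
  intro j t ht
  obtain ⟨i, rfl⟩ : ∃ i, s i = t := by
    rcases ht with rfl | rfl | rfl | rfl
    exacts [⟨0, rfl⟩, ⟨1, rfl⟩, ⟨2, rfl⟩, ⟨3, rfl⟩]
  change W ≤ W.comap (translateBy _)
  refine sup_le (fun w hw => Submodule.mem_sup_left (hUinv _ hw)) ?_
  rw [Submodule.span_le, Set.singleton_subset_iff]
  have h1 : translateBy (Pi.single j (s i)) f - f ∈ W := Submodule.mem_sup_left
    (Submodule.mem_iSup_of_mem (p := fun p : Fin d × Fin 4 => V (Pi.single p.1 (s p.2)))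
      (j, i) (hVmem _))
  simpa using W.add_mem h1 hfW

open Matrix in
theorem isTranslationFinite_of_sum_mem {d : ℕ} {ι : Type*} [DecidableEq ι]
    {b c : ι → Matrix (Fin d) (Fin d) ℝ} (hb : ∀ i, IsUnit (b i)) (hc : ∀ i, IsUnit (c i))
    (hij : ∀ i j, i ≠ j → IsUnit ((b i)⁻¹ * c i - (b j)⁻¹ * c j)) (i₀ : ι) (s : Finset ι)
    (hs : i₀ ∉ s) (f : ι → (Fin d → ℝ) → ℂ) (hf : ∀ i, Continuous (f i))
    (V : Submodule ℂ ((Fin d → ℝ) → ℂ)) [FiniteDimensional ℂ V]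
    (hV : ∀ y, (fun x => ∑ i ∈ insert i₀ s, f i (b i *ᵥ x + c i *ᵥ y)) ∈ V) :
    IsTranslationFinite (f i₀) := by
  have hinv : ∀ (A : Matrix (Fin d) (Fin d) ℝ), IsUnit A → ∀ x, A *ᵥ (A⁻¹ *ᵥ x) = x := by
    intro A hA x
    rw [mulVec_mulVec, mul_nonsing_inv _ ((isUnit_iff_isUnit_det A).1 hA), one_mulVec]
  induction s using Finset.induction_on generalizing f V with
  | empty =>
    let V' := V.map (LinearMap.funLeft ℂ ℂ (fun x => (b i₀)⁻¹ *ᵥ x))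
    have hV' : ∀ h, translateBy h (f i₀) ∈ V' := by
      intro h
      refine ⟨_, hV ((c i₀)⁻¹ *ᵥ h), ?_⟩
      funext x
      simp [-mulVec_mulVec, LinearMap.funLeft_apply, hinv _ (hb i₀), hinv _ (hc i₀)]
    let W := Submodule.span ℂ (Set.range fun h => translateBy h (f i₀))
    have hW : W ≤ V' := by
      rw [Submodule.span_le]
      rintro _ ⟨h, rfl⟩
      exact hV' h
    refine ⟨W, Submodule.finiteDimensional_of_le hW, fun h => ?_, fun w hw => ?_,
      Submodule.subset_span ⟨0, translateBy_zero _⟩⟩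
    · change W ≤ W.comap (translateBy h)
      rw [Submodule.span_le]
      rintro _ ⟨k, rfl⟩
      exact Submodule.subset_span ⟨h + k, translateBy_add _ _ _⟩
    · induction hw using Submodule.span_induction with
      | mem w hw =>
        obtain ⟨h, rfl⟩ := hw
        exact (hf i₀).translateBy h
      | zero => exact continuous_zero
      | add v w _ _ hv hw => exact hv.add hw
      | smul a w _ hw => exact hw.const_smul a
  | insert j s hj ih =>
    have hne : i₀ ≠ j := fun h => hs (by simp [h])
    refine isTranslationFinite_of_difference (hf i₀) fun h => ?_
    let k := ((b i₀)⁻¹ * c i₀ - (b j)⁻¹ * c j)⁻¹ *ᵥ ((b i₀)⁻¹ *ᵥ h)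
    let l := -((b j)⁻¹ *ᵥ (c j *ᵥ k))
    have hl : b j *ᵥ l + c j *ᵥ k = 0 := by
      simp [-mulVec_mulVec, l, mulVec_neg, hinv _ (hb j)]
    have hh : b i₀ *ᵥ l + c i₀ *ᵥ k = h := by
      have h1 := hinv _ (hij i₀ j hne) ((b i₀)⁻¹ *ᵥ h)
      have h2 := congrArg (fun x => b i₀ *ᵥ x) h1
      simp only [hinv _ (hb i₀), sub_mulVec, mulVec_sub, ← mulVec_mulVec] at h2
      rw [← h2]
      simp only [l, mulVec_neg, k]
      abel
    let g : ι → (Fin d → ℝ) → ℂ := fun i => translateBy (b i *ᵥ l + c i *ᵥ k) (f i) - f i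
    have hg := ih (fun h => hs (by simp [h])) g (fun i => ((hf i).translateBy _).sub (hf i))
      (V.map (translateBy l) ⊔ V) ?_
    · simpa only [g, hh] using hg
    intro y
    have hgj : g j = 0 := by simp [g, hl]
    have hmem : translateBy l (fun x => ∑ i ∈ insert i₀ (insert j s),
        f i (b i *ᵥ x + c i *ᵥ (y + k))) -
        (fun x => ∑ i ∈ insert i₀ (insert j s), f i (b i *ᵥ x + c i *ᵥ y)) ∈
        V.map (translateBy l) ⊔ V :=
      Submodule.sub_mem _ (Submodule.mem_sup_left ⟨_, hV (y + k), rfl⟩)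
        (Submodule.mem_sup_right (hV y))
    convert hmem using 1
    funext x
    rw [Pi.sub_apply, translateBy_apply, ← Finset.sum_sub_distrib, Finset.insert_comm,
      Finset.sum_insert (a := j) (by simp [hj, hne.symm])]
    have h0 : f j (b j *ᵥ (x + l) + c j *ᵥ (y + k)) - f j (b j *ᵥ x + c j *ᵥ y) = 0 := by
      have := congrFun hgj (b j *ᵥ x + c j *ᵥ y)
      simp only [g, Pi.sub_apply, translateBy_apply, Pi.zero_apply] at this
      rw [← this, mulVec_add, mulVec_add]
      congr 2
      abel
    rw [h0, zero_add]
    refine Finset.sum_congr rfl fun i _ => ?_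
    simp only [g, Pi.sub_apply, translateBy_apply, mulVec_add]
    congr 2
    abel

theorem stmt_1 {d m n : ℕ} (hd : 0 < d) (hm : 0 < m) (hn : 0 < n)
    (b c : Fin m → Matrix (Fin d) (Fin d) ℝ)
    (hb : ∀ i, IsUnit (b i)) (hc : ∀ i, IsUnit (c i))
    (hij : ∀ i j, i ≠ j → IsUnit ((b i)⁻¹ * c i - (b j)⁻¹ * c j))
    (f : Fin m → (Fin d → ℝ) → ℂ) (hf : ∀ i, Continuous (f i))
    (u v : Fin n → (Fin d → ℝ) → ℂ)
    (hu : ∀ k, Continuous (u k)) (hv : ∀ k, Continuous (v k))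
    (heq : ∀ x y : Fin d → ℝ,
      ∑ i, f i ((b i).mulVec x + (c i).mulVec y) = ∑ k, u k y * v k x) :
    ∀ i, IsExpPoly (f i) := by
  intro i
  have := FiniteDimensional.span_of_finite ℂ (Set.finite_range v)
  refine (isTranslationFinite_of_sum_mem hb hc hij i (Finset.univ.erase i) (by simp) f hf
    (Submodule.span ℂ (Set.range v)) fun y => ?_).isExpPoly
  rw [Finset.insert_erase (Finset.mem_univ i)]
  have : (fun x => ∑ i, f i ((b i).mulVec x + (c i).mulVec y)) = ∑ k, u k y • v k := by
    funext x
    simp [heq]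
  rw [this]
  exact Submodule.sum_mem _ fun k _ => Submodule.smul_mem _ _ (Submodule.subset_span ⟨k, rfl⟩)
end

section
/- Let d ≥ 1 and r, s ≥ 0 be integers and let c be an invertible real d×d matrix. Let f : ℝ^d → ℂ be continuous, and for each multi-index α ∈ ℕ^d with |α| ≤ r and each multi-index β ∈ ℕ^d with |β| ≤ s let a_α : ℝ^d → ℂ and b_β : ℝ^d → ℂ be continuous functions. If f(x + c y) = ∑_{|α| ≤ r} x^α a_α(y) + ∑_{|β| ≤ s} b_β(x) y^β holds for all x, y ∈ ℝ^d, then f is a polynomial function. -/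
/-- `f : ℝ^d → ℂ` is a polynomial function: it agrees with the evaluation of a
multivariate polynomial in `d` variables with complex coefficients. -/
def IsPolyFun {d : ℕ} (f : (Fin d → ℝ) → ℂ) : Prop :=
  ∃ p : MvPolynomial (Fin d) ℂ,
    ∀ x : Fin d → ℝ, f x = MvPolynomial.eval (fun j => (x j : ℂ)) p

open Finset in
/-- The `n`-th forward difference, with any step, of a polynomial of degree `< n` vanishes. -/
theorem fwdDiff_iter_ofReal_eval_eq_zero {P : Polynomial ℂ} {n : ℕ} (hP : P.natDegree < n)
    (h t : ℝ) : (fwdDiff h)^[n] (fun u : ℝ => P.eval (u : ℂ)) t = 0 := by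
  have hQ : (P.comp (Polynomial.C (t : ℂ) + Polynomial.C (h : ℂ) * Polynomial.X)).natDegree <
      n := by
    have h1 : (Polynomial.C (t : ℂ) + Polynomial.C (h : ℂ) * Polynomial.X).natDegree ≤ 1 := by
      compute_degree
    have h2 := Polynomial.natDegree_comp_le.trans (Nat.mul_le_mul_left P.natDegree h1)
    omega
  have := congrFun (Polynomial.fwdDiff_iter_eq_zero_of_degree_lt hQ) 0
  rw [fwdDiff_iter_eq_sum_shift] at this ⊢
  rw [Pi.zero_apply] at this
  rw [← this]
  refine sum_congr rfl fun k _ => ?_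
  simp [Polynomial.eval_comp, mul_comm (h : ℂ)]

open Finset in
/-- A function on an arithmetic progression whose `n`-th forward differences vanish is there a
polynomial of degree `< n` in the index. -/
theorem exists_degree_lt_forall_eval_natCast_eq {g : ℝ → ℂ} {n : ℕ} {h : ℝ}
    (hg : (fwdDiff h)^[n] g = 0) (t : ℝ) :
    ∃ Q : Polynomial ℂ, Q.degree < n ∧ ∀ i : ℕ, Q.eval (i : ℂ) = g (t + i * h) := by
  have hz : ∀ k, n ≤ k → (fwdDiff h)^[k] g t = 0 := by
    intro k hk
    obtain ⟨m, rfl⟩ := Nat.exists_eq_add_of_le' hk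
    rw [Function.iterate_add_apply, hg, fwdDiff_iter_eq_sum_shift]
    simp
  refine ⟨∑ k ∈ range n, Polynomial.C ((fwdDiff h)^[k] g t / (k.factorial : ℂ)) *
    descPochhammer ℂ k, ?_, fun i => ?_⟩
  · refine (Polynomial.degree_sum_le _ _).trans_lt ((Finset.sup_lt_iff (WithBot.bot_lt_coe n)).2 ?_)
    intro k hk
    refine Polynomial.degree_le_natDegree.trans_lt ?_
    refine WithBot.coe_lt_coe.2 ((Polynomial.natDegree_C_mul_le _ _).trans_lt ?_)
    rw [descPochhammer_natDegree]
    exact mem_range.1 hk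
  · rw [← nsmul_eq_mul, shift_eq_sum_fwdDiff_iter h g i t, Polynomial.eval_finsetSum]
    have h1 : ∀ k, Polynomial.eval (i : ℂ) (Polynomial.C ((fwdDiff h)^[k] g t / (k.factorial : ℂ)) *
        descPochhammer ℂ k) = i.choose k • (fwdDiff h)^[k] g t := by
      intro k
      have : (k.factorial : ℂ) ≠ 0 := by exact_mod_cast k.factorial_ne_zero
      rw [Polynomial.eval_mul, Polynomial.eval_C, descPochhammer_eval_eq_descFactorial,
        Nat.descFactorial_eq_factorial_mul_choose, nsmul_eq_mul]
      push_cast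
      field_simp
    simp_rw [h1]
    trans ∑ k ∈ range (n + (i + 1)), i.choose k • (fwdDiff h)^[k] g t
    · refine sum_subset (range_mono (by omega)) fun k _ hk => ?_
      rw [hz k (by simpa using hk), smul_zero]
    · symm
      refine sum_subset (range_mono (by omega)) fun k _ hk => ?_
      rw [Nat.choose_eq_zero_of_lt (by rw [mem_range] at hk; omega), zero_smul]

open Finset in
/-- **Fréchet's theorem** on the line: a continuous function whose `n`-th forward differences vanish
for all steps is the polynomial interpolating it at `0, …, n - 1`. -/
theorem eq_eval_interpolate_of_fwdDiff_iter_eq_zero {g : ℝ → ℂ} (hg : Continuous g) {n : ℕ}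
    (hΔ : ∀ h, (fwdDiff h)^[n] g = 0) (t : ℝ) :
    g t = (Lagrange.interpolate (range n) (fun k : ℕ => (k : ℂ)) (fun k : ℕ => g k)).eval
      (t : ℂ) := by
  set P := Lagrange.interpolate (range n) (fun k : ℕ => (k : ℂ)) (fun k : ℕ => g k) with hPdef
  have hinj : Set.InjOn (fun k : ℕ => (k : ℂ)) (range n) := Nat.cast_injective.injOn
  have hPdeg : P.degree < n := by
    simpa only [card_range] using Lagrange.degree_interpolate_lt (fun k : ℕ => g k) hinj
  have hPc : Continuous fun u : ℝ => P.eval (u : ℂ) := by fun_prop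
  have hrat : ∀ q : ℚ, g q = P.eval ((q : ℝ) : ℂ) := by
    intro q
    obtain ⟨N, hN⟩ := exists_nat_ge (-q)
    have hden : (q.den : ℝ) ≠ 0 := by exact_mod_cast q.den_nz
    obtain ⟨Q, hQdeg, hQ⟩ := exists_degree_lt_forall_eval_natCast_eq
      (hΔ ((q.den : ℝ)⁻¹)) (-(N : ℝ))
    -- the interpolant, read along the same progression
    have hlin : (Polynomial.C (-(N : ℂ)) + Polynomial.C ((q.den : ℂ)⁻¹) *
        Polynomial.X).natDegree ≤ 1 := by
      compute_degree
    set R := P.comp (Polynomial.C (-(N : ℂ)) + Polynomial.C ((q.den : ℂ)⁻¹) * Polynomial.X) with hR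
    have hRdeg : R.degree < n := by
      rcases eq_or_ne P 0 with h0 | h0
      · rw [hR, h0, Polynomial.zero_comp, Polynomial.degree_zero]; exact WithBot.bot_lt_coe n
      · refine Polynomial.degree_le_natDegree.trans_lt ?_
        have h1 : P.natDegree < n := (Polynomial.natDegree_lt_iff_degree_lt h0).2 hPdeg
        have h2 : R.natDegree ≤ P.natDegree * 1 :=
          Polynomial.natDegree_comp_le.trans (Nat.mul_le_mul_left _ hlin)
        exact_mod_cast (by omega : R.natDegree < n)
    have hQR : Q = R := by
      refine Polynomial.eq_of_degrees_lt_of_eval_index_eq (s := range n)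
        (v := fun k : ℕ => (((k + N) * q.den : ℕ) : ℂ)) ?_ (by simpa using hQdeg)
        (by simpa using hRdeg) ?_
      · intro k _ l _ hkl
        have := Nat.eq_of_mul_eq_mul_right q.den_pos (Nat.cast_injective hkl)
        omega
      · intro k hk
        have hden' : (q.den : ℂ) ≠ 0 := by exact_mod_cast q.den_nz
        have e1 : (-(N : ℝ)) + (((k + N) * q.den : ℕ) : ℝ) * (q.den : ℝ)⁻¹ = k := by
          push_cast; field_simp; ring
        have e2 : (-(N : ℂ)) + (q.den : ℂ)⁻¹ * (((k + N) * q.den : ℕ) : ℂ) = k := by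
          push_cast; field_simp; ring
        have e3 := Lagrange.eval_interpolate_at_node (fun k : ℕ => g k) hinj hk
        rw [hQ, e1, hR, Polynomial.eval_comp]
        simp only [Polynomial.eval_add, Polynomial.eval_C, Polynomial.eval_mul, Polynomial.eval_X]
        rw [e2, e3]
    have hnum : 0 ≤ q.num + N * q.den := by
      have h1 : (0 : ℚ) ≤ (q + N) * q.den := mul_nonneg (by linarith) (by positivity)
      rw [add_mul, Rat.mul_den_eq_num] at h1
      exact_mod_cast h1
    obtain ⟨i, hi⟩ := Int.eq_ofNat_of_zero_le hnum
    have hiq : (i : ℚ) = (q + N) * q.den := by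
      rw [add_mul, Rat.mul_den_eq_num]; exact_mod_cast hi.symm
    have hir : -(N : ℝ) + (i : ℝ) * (q.den : ℝ)⁻¹ = q := by
      have : (i : ℝ) = (q + N) * q.den := by exact_mod_cast hiq
      rw [this]; field_simp; ring
    have hic : -(N : ℂ) + (q.den : ℂ)⁻¹ * (i : ℂ) = ((q : ℝ) : ℂ) := by
      rw [← hir]; push_cast; ring
    have := hQ i
    rw [hir, hQR, hR, Polynomial.eval_comp] at this
    simp only [Polynomial.eval_add, Polynomial.eval_C, Polynomial.eval_mul,
      Polynomial.eval_X] at this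
    rw [hic] at this
    exact this.symm
  exact congrFun (Rat.denseRange_cast.equalizer hg hPc (funext hrat)) t

open Finset in
/-- A decomposition of `g (t + τ)` into finitely many products in which one factor is a polynomial,
in `t` of degree `≤ r` or in `τ` of degree `≤ s`, forces the differences of `g` of order
`r + s + 2` to vanish. -/
theorem fwdDiff_iter_eq_zero_of_add_eq_sum {ι κ : Type*} {r s : ℕ} (A : Finset ι) (B : Finset κ)
    {g : ℝ → ℂ} {p : ι → Polynomial ℂ} {q : κ → Polynomial ℂ} {a : ι → ℝ → ℂ} {b : κ → ℝ → ℂ}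
    (hp : ∀ i ∈ A, (p i).natDegree ≤ r) (hq : ∀ j ∈ B, (q j).natDegree ≤ s)
    (hg : ∀ t τ : ℝ, g (t + τ) = ∑ i ∈ A, (p i).eval (t : ℂ) * a i τ +
      ∑ j ∈ B, b j t * (q j).eval (τ : ℂ)) (h : ℝ) :
    (fwdDiff h)^[s + 1 + (r + 1)] g = 0 := by
  have h1 : (fwdDiff h)^[r + 1] g =
      ∑ j ∈ B, ((fwdDiff h)^[r + 1] (b j) 0) • fun τ : ℝ => (q j).eval (τ : ℂ) := by
    funext τ
    have h2 : (fun t => g (t + τ)) = ∑ i ∈ A, a i τ • (fun t : ℝ => (p i).eval (t : ℂ)) +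
        ∑ j ∈ B, (q j).eval (τ : ℂ) • b j := by
      funext t
      simp [hg, mul_comm]
    have h3 := fwdDiff_iter_comp_add h g τ (r + 1) 0
    rw [zero_add] at h3
    rw [← h3, h2, fwdDiff_iter_add, fwdDiff_iter_finsetSum, fwdDiff_iter_finsetSum]
    simp only [fwdDiff_iter_const_smul, Pi.add_apply, Finset.sum_apply, Pi.smul_apply, smul_eq_mul]
    rw [sum_eq_zero (s := A), zero_add]
    · exact sum_congr rfl fun _ _ => mul_comm _ _
    · intro i hi
      rw [fwdDiff_iter_ofReal_eval_eq_zero (Nat.lt_succ_of_le (hp i hi)), mul_zero]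
  rw [Function.iterate_add_apply, h1, fwdDiff_iter_finsetSum]
  refine sum_eq_zero fun j hj => ?_
  rw [fwdDiff_iter_const_smul]
  funext t
  rw [Pi.smul_apply, fwdDiff_iter_ofReal_eval_eq_zero (Nat.lt_succ_of_le (hq j hj)), smul_zero,
    Pi.zero_apply]

open Finset in
/-- A function which depends only on the coordinates in `S`, and which in each of them is given by
interpolation at `0, …, n - 1`, is a polynomial function. -/
theorem isPolyFun_of_forall_eq_interpolate {d : ℕ} (n : ℕ) (S : Finset (Fin d))
    (f : (Fin d → ℝ) → ℂ) (hS : ∀ x y : Fin d → ℝ, (∀ j ∈ S, x j = y j) → f x = f y)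
    (hf : ∀ j ∈ S, ∀ (x : Fin d → ℝ) (t : ℝ), f (Function.update x j t) =
      (Lagrange.interpolate (range n) (fun k : ℕ => (k : ℂ))
        (fun k : ℕ => f (Function.update x j k))).eval (t : ℂ)) :
    IsPolyFun f := by
  induction S using Finset.induction_on generalizing f with
  | empty => exact ⟨MvPolynomial.C (f 0), fun x => by simpa using hS x 0 (by simp)⟩
  | insert j S hj ih =>
    have key : ∀ k : ℕ, IsPolyFun fun x => f (Function.update x j k) := by
      intro k
      refine ih _ (fun x y hxy => hS _ _ fun i hi => ?_) fun i hi x t => ?_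
      · rcases eq_or_ne i j with rfl | hij
        · simp
        · simpa [hij] using hxy i ((mem_insert.1 hi).resolve_left hij)
      · have hij : i ≠ j := fun e => hj (e ▸ hi)
        simp only [Function.update_comm hij]
        exact hf i (mem_insert_of_mem hi) _ t
    choose p hp using key
    refine ⟨∑ k ∈ range n, p k * Polynomial.aeval (MvPolynomial.X j)
      (Lagrange.basis (range n) (fun k : ℕ => (k : ℂ)) k), fun x => ?_⟩
    have := hf j (mem_insert_self j S) x (x j)
    rw [Function.update_eq_self, Lagrange.interpolate_apply, Polynomial.eval_finsetSum] at this
    rw [this, map_sum]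
    refine sum_congr rfl fun k _ => ?_
    rw [map_mul, ← hp k x, Polynomial.eval_mul, Polynomial.eval_C]
    congr 1
    rw [← MvPolynomial.coe_aeval_eq_eval, RingHom.coe_coe, ← Polynomial.aeval_algHom_apply]
    simp [Polynomial.aeval_def, Polynomial.eval₂_eq_eval_map]

/-- A monomial restricted to the line `t ↦ x + t v`, as a polynomial in `t`. -/
noncomputable def lineMonomial {d : ℕ} (x v : Fin d → ℝ) (α : Fin d → ℕ) : Polynomial ℂ :=
  ∏ j, (Polynomial.C (x j : ℂ) + Polynomial.C (v j : ℂ) * Polynomial.X) ^ α j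

theorem eval_lineMonomial {d : ℕ} (x v : Fin d → ℝ) (α : Fin d → ℕ) (t : ℝ) :
    (lineMonomial x v α).eval (t : ℂ) = ∏ j, (((x + t • v) j : ℝ) : ℂ) ^ α j := by
  simp [lineMonomial, Polynomial.eval_prod, mul_comm (t : ℂ)]

theorem natDegree_lineMonomial_le {d : ℕ} (x v : Fin d → ℝ) (α : Fin d → ℕ) :
    (lineMonomial x v α).natDegree ≤ ∑ j, α j := by
  refine (Polynomial.natDegree_prod_le _ _).trans (Finset.sum_le_sum fun j _ => ?_)
  refine Polynomial.natDegree_pow_le.trans ?_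
  have h1 : (Polynomial.C (x j : ℂ) +
    Polynomial.C (v j : ℂ) * Polynomial.X).natDegree ≤ 1 := by
    compute_degree
  exact (Nat.mul_le_mul_left (α j) h1).trans_eq (mul_one _)

theorem stmt_3 {d : ℕ} (hd : 0 < d) (r s : ℕ)
    (c : Matrix (Fin d) (Fin d) ℝ) (hc : IsUnit c)
    (f : (Fin d → ℝ) → ℂ) (hf : Continuous f)
    (a : (Fin d → Fin (r + 1)) → (Fin d → ℝ) → ℂ)
    (b : (Fin d → Fin (s + 1)) → (Fin d → ℝ) → ℂ)
    (ha : ∀ α, Continuous (a α)) (hb : ∀ β, Continuous (b β))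
    (heq : ∀ x y : Fin d → ℝ,
      f (x + c.mulVec y) =
        (∑ α ∈ Finset.univ.filter (fun α : Fin d → Fin (r + 1) => ∑ j, (α j : ℕ) ≤ r),
            (∏ j, (x j : ℂ) ^ (α j : ℕ)) * a α y)
        + ∑ β ∈ Finset.univ.filter (fun β : Fin d → Fin (s + 1) => ∑ j, (β j : ℕ) ≤ s),
            b β x * ∏ j, (y j : ℂ) ^ (β j : ℕ)) :
    IsPolyFun f := by
  refine isPolyFun_of_forall_eq_interpolate (s + 1 + (r + 1)) Finset.univ f
    (fun x y hxy => congrArg f (funext fun j => hxy j (Finset.mem_univ j))) fun j _ x t => ?_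
  have hcont : Continuous fun t : ℝ => f (Function.update x j t) :=
    hf.comp (continuous_const.update j continuous_id)
  refine eq_eval_interpolate_of_fwdDiff_iter_eq_zero hcont (fun h => ?_) t
  obtain ⟨v, hv⟩ : ∃ v, c.mulVec v = Pi.single j (1 : ℝ) :=
    Matrix.mulVec_surjective_iff_isUnit.2 hc _
  have hline : ∀ t τ : ℝ, Function.update x j (t + τ) =
      (Function.update x j 0 + t • Pi.single j (1 : ℝ)) + c.mulVec (τ • v) := by
    intro t τ
    rw [Matrix.mulVec_smul, hv]
    funext i
    rcases eq_or_ne i j with rfl | hij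
    · simp
    · simp [hij]
  refine fwdDiff_iter_eq_zero_of_add_eq_sum
    (Finset.univ.filter fun α : Fin d → Fin (r + 1) => ∑ j, (α j : ℕ) ≤ r)
    (Finset.univ.filter fun β : Fin d → Fin (s + 1) => ∑ j, (β j : ℕ) ≤ s)
    (p := fun α => lineMonomial (Function.update x j 0) (Pi.single j 1) fun i => (α i : ℕ))
    (q := fun β => lineMonomial 0 v fun i => (β i : ℕ))
    (a := fun α τ => a α (τ • v))
    (b := fun β t => b β (Function.update x j 0 + t • Pi.single j 1))
    (fun α hα => (natDegree_lineMonomial_le _ _ _).trans (Finset.mem_filter.1 hα).2)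
    (fun β hβ => (natDegree_lineMonomial_le _ _ _).trans (Finset.mem_filter.1 hβ).2)
    (fun t τ => ?_) h
  simp only [eval_lineMonomial, zero_add]
  rw [hline, heq]
end

section
/- Let d, m ≥ 1 be integers and let b_1, …, b_m, c_1, …, c_m be invertible real d×d matrices such that b_i^{-1} c_i − b_j^{-1} c_j is invertible whenever i ≠ j. Let f_1, …, f_m : ℝ^d → ℂ be continuous functions satisfying the Skitovich–Darmois-type equation ∑_{i=1}^m f_i(b_i x + c_i y) = ∑_{i=1}^m f_i(b_i x) + ∑_{i=1}^m f_i(c_i y) for all x, y ∈ ℝ^d. Then the functions P(x) = ∑_{i=1}^m f_i(b_i x) and Q(y) = ∑_{i=1}^m f_i(c_i y) are polynomial functions of total degree at most m. -/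
/-- `f : ℝ^d → ℂ` is a polynomial function of total degree at most `m`. -/
def IsPolyFunOfDegLE {d : ℕ} (f : (Fin d → ℝ) → ℂ) (m : ℕ) : Prop :=
  ∃ p : MvPolynomial (Fin d) ℂ, p.totalDegree ≤ m ∧
    ∀ x : Fin d → ℝ, f x = MvPolynomial.eval (fun j => (x j : ℂ)) p

open MvPolynomial Filter Topology fwdDiff

/-- All `n`-fold iterated forward differences of `f` vanish. -/
def FwdDiffVanish {M G : Type*} [AddCommMonoid M] [AddCommGroup G] : ℕ → (M → G) → Prop
  | 0, f => f = 0
  | n + 1, f => ∀ h, FwdDiffVanish n (Δ_[h] f)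

namespace FwdDiffVanish

variable {M G : Type*} [AddCommMonoid M] [AddCommGroup G]

lemma iterate {n i : ℕ} {f : M → G} (hf : FwdDiffVanish (n + i) f) (h : M) :
    FwdDiffVanish n ((Δ_[h])^[i] f) := by
  induction i generalizing f with
  | zero => exact hf
  | succ i ih => exact ih (hf h)

lemma iterate_eq_zero {n i : ℕ} {f : M → G} (hf : FwdDiffVanish n f) (hi : n ≤ i) (h : M) :
    (Δ_[h])^[i] f = 0 := by
  obtain ⟨k, rfl⟩ := Nat.exists_eq_add_of_le' hi
  have h0 : (Δ_[h])^[n] f = 0 := iterate (n := 0) (by simpa using hf) h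
  rw [Function.iterate_add_apply, h0]
  exact Function.iterate_fixed (by ext; simp [fwdDiff]) k

end FwdDiffVanish

lemma exists_totalDegree_le_eval_eq_choose {σ : Type*} (j : σ) (n : ℕ) :
    ∃ p : MvPolynomial σ ℂ, p.totalDegree ≤ n ∧
      ∀ k : σ → ℕ, eval (fun i => (k i : ℂ)) p = (k j).choose n := by
  obtain ⟨p, hp, hp'⟩ : ∃ p : MvPolynomial σ ℂ, p.totalDegree ≤ n ∧
      ∀ x : σ → ℂ, eval x p = (descPochhammer ℂ n).eval (x j) := by
    induction n with
    | zero => exact ⟨1, by simp, by simp⟩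
    | succ n ih =>
      obtain ⟨p, hp, hp'⟩ := ih
      refine ⟨p * (X j - C (n : ℂ)), (totalDegree_mul _ _).trans (add_le_add hp ?_), fun x => ?_⟩
      · exact (totalDegree_sub _ _).trans (max_le (totalDegree_X j).le (by rw [totalDegree_C]; omega))
      · simp [hp', descPochhammer_succ_eval]
  refine ⟨(n.factorial : ℂ)⁻¹ • p, (totalDegree_smul_le _ _).trans hp, fun k => ?_⟩
  rw [smul_eval, hp', Nat.cast_choose_eq_descPochhammer_div, div_eq_inv_mul]

/-- On the finitely generated cone `a + ∑ ℕ • h j`, a function with vanishing differences of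
order `n + 1` is a polynomial of total degree at most `n` in the coefficients. -/
lemma FwdDiffVanish.exists_eval_eq {M σ : Type*} [AddCommMonoid M] (a : M) (h : σ → M)
    (s : Finset σ) {n : ℕ} {f : M → ℂ} (hf : FwdDiffVanish (n + 1) f) :
    ∃ p : MvPolynomial σ ℂ, p.totalDegree ≤ n ∧
      ∀ k : σ → ℕ, f (a + ∑ j ∈ s, k j • h j) = eval (fun j => (k j : ℂ)) p := by
  classical
  induction s using Finset.induction_on generalizing n f with
  | empty => exact ⟨C (f a), by simp, by simp⟩
  | insert j s hj ih =>
    have key : ∀ i, ∃ p : MvPolynomial σ ℂ, i ≤ n → p.totalDegree ≤ n - i ∧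
        ∀ k : σ → ℕ, (Δ_[h j])^[i] f (a + ∑ j ∈ s, k j • h j) =
          eval (fun j => (k j : ℂ)) p := by
      intro i
      by_cases hi : i ≤ n
      · obtain ⟨p, hp⟩ := ih (n := n - i)
          (FwdDiffVanish.iterate (i := i) (by convert hf using 1; omega) (h j))
        exact ⟨p, fun _ => hp⟩
      · exact ⟨0, fun h => absurd h hi⟩
    choose p hp using key
    choose q hq hq' using exists_totalDegree_le_eval_eq_choose j
    refine ⟨∑ i ∈ Finset.range (n + 1), q i * p i, totalDegree_finsetSum_le fun i hi => ?_,
      fun k => ?_⟩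
    · have hi : i ≤ n := Nat.lt_succ_iff.mp (Finset.mem_range.mp hi)
      have h1 := totalDegree_mul (q i) (p i)
      have h2 := hq i
      have h3 := (hp i hi).1
      omega
    · rw [Finset.sum_insert hj, add_comm (k j • h j), ← add_assoc, shift_eq_sum_fwdDiff_iter (h j) f,
        map_sum]
      have hz : ∀ i, n + 1 ≤ i →
          (k j).choose i • (Δ_[h j])^[i] f (a + ∑ j ∈ s, k j • h j) = 0 := fun i hi => by
        simp [hf.iterate_eq_zero hi]
      have hz' : ∀ i, k j + 1 ≤ i →
          (k j).choose i • (Δ_[h j])^[i] f (a + ∑ j ∈ s, k j • h j) = 0 := fun i hi => by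
        simp [Nat.choose_eq_zero_of_lt hi]
      trans ∑ i ∈ Finset.range (n + 1),
        (k j).choose i • (Δ_[h j])^[i] f (a + ∑ j ∈ s, k j • h j)
      · rcases le_total (n + 1) (k j + 1) with hle | hle
        · refine (Finset.sum_subset (Finset.range_mono hle) fun i _ hi => hz i ?_).symm
          simpa using hi
        · refine Finset.sum_subset (Finset.range_mono hle) fun i _ hi => hz' i ?_
          simpa using hi
      · refine Finset.sum_congr rfl fun i hi => ?_
        have hi : i ≤ n := Nat.lt_succ_iff.mp (Finset.mem_range.mp hi)
        rw [map_mul, hq', (hp i hi).2, nsmul_eq_mul]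

lemma eval_bind₁_eq_eval {σ τ R : Type*} [CommSemiring R] (g : σ → MvPolynomial τ R) (x : τ → R)
    (p : MvPolynomial σ R) : eval x (bind₁ g p) = eval (fun i => eval x (g i)) p :=
  eval₂Hom_bind₁ (RingHom.id R) x g p

/-- The Fréchet theorem for continuous functions on `ℝ^d`. -/
lemma FwdDiffVanish.isPolyFunOfDegLE {d n : ℕ} {f : (Fin d → ℝ) → ℂ} (hc : Continuous f)
    (hf : FwdDiffVanish (n + 1) f) : IsPolyFunOfDegLE f n := by
  have hsum : ∀ (t : ℝ) (k : Fin d → ℕ), ∑ j, k j • (Pi.single j t : Fin d → ℝ) =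
      fun j => (k j : ℝ) * t := fun t k => by
    ext i
    simp [Finset.sum_apply, Pi.single_apply]
  obtain ⟨p, hp, hpf⟩ := hf.exists_eval_eq 0 (fun j => Pi.single j (1 : ℝ)) Finset.univ
  simp only [hsum, zero_add, mul_one] at hpf
  have hlattice : ∀ (K N : ℕ) (k : Fin d → ℕ),
      f (fun j => -(K : ℝ) + k j * ((N + 1 : ℕ) : ℝ)⁻¹) =
        eval (fun j => ((-(K : ℝ) + k j * ((N + 1 : ℕ) : ℝ)⁻¹ : ℝ) : ℂ)) p := by
    intro K N
    obtain ⟨q, -, hqf⟩ := hf.exists_eval_eq (fun _ => -(K : ℝ))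
      (fun j => Pi.single j ((N + 1 : ℕ) : ℝ)⁻¹) Finset.univ
    simp only [hsum] at hqf
    have hN : ((N + 1 : ℕ) : ℝ) ≠ 0 := by positivity
    have hN' : ((N + 1 : ℕ) : ℂ) ≠ 0 := Nat.cast_ne_zero.mpr N.succ_ne_zero
    have hq : q = bind₁ (fun j => C (-(K : ℂ)) + X j * C ((N + 1 : ℕ) : ℂ)⁻¹) p := by
      refine funext_set (fun _ => Set.range fun k : ℕ => (((N + 1) * (k + K) : ℕ) : ℂ))
        (fun _ => Set.infinite_range_of_injective fun a b hab => ?_) fun x hx => ?_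
      · simpa [N.cast_add_one_ne_zero] using hab
      · choose k hk using fun j => hx j (Set.mem_univ j)
        obtain rfl : (fun j => (((N + 1) * (k j + K) : ℕ) : ℂ)) = x := _root_.funext hk
        rw [← hqf, eval_bind₁_eq_eval]
        convert hpf k using 2
        · ext j
          simp only [Pi.add_apply]
          push_cast at hN ⊢
          field_simp
          ring
        · congr 1
          ext j
          simp only [map_add, map_mul, eval_C, eval_X]
          push_cast at hN' ⊢
          field_simp
          ring
    intro k
    refine (hqf k).trans ?_
    rw [hq, eval_bind₁_eq_eval]
    congr 2
    ext j
    simp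
  refine ⟨p, hp, fun x => ?_⟩
  obtain ⟨K, hK⟩ := exists_nat_ge (∑ j, |x j|)
  have hxK : ∀ j, 0 ≤ x j + K := fun j => by
    have := Finset.single_le_sum (fun i _ => abs_nonneg (x i)) (Finset.mem_univ j)
    linarith [neg_abs_le (x j)]
  have hlim : Tendsto (fun (N : ℕ) (j : Fin d) =>
      -(K : ℝ) + (⌊(x j + K) * ((N + 1 : ℕ) : ℝ)⌋₊ : ℝ) * ((N + 1 : ℕ) : ℝ)⁻¹) atTop (𝓝 x) := by
    refine tendsto_pi_nhds.mpr fun j => ?_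
    have := ((tendsto_nat_floor_mul_div_atTop (hxK j)).comp
      (tendsto_natCast_atTop_atTop.comp (tendsto_add_atTop_nat 1))).const_add (-(K : ℝ))
    simpa [div_eq_mul_inv, Function.comp_def] using this
  have hpc : Continuous fun y : Fin d → ℝ => eval (fun j => (y j : ℂ)) p :=
    (continuous_eval p).comp (by fun_prop)
  refine tendsto_nhds_unique ((hc.tendsto x).comp hlim) ?_
  convert (hpc.tendsto x).comp hlim using 1
  ext N
  exact hlattice K N _

/-- Elimination of the summands in the equation `∑ g i (x + A i y) = P x + Q y`. -/
lemma fwdDiffVanish_of_sum_eq {E G : Type*} [AddCommGroup E] [AddCommGroup G] {n : ℕ}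
    (A : Fin n → E →+ E) (hA : ∀ i, Function.Surjective (A i)) (g : Fin n → E → G)
    (P Q : E → G) (h : ∀ x y, ∑ i, g i (x + A i y) = P x + Q y) :
    FwdDiffVanish (n + 1) P ∧ FwdDiffVanish (n + 1) Q := by
  induction n generalizing P Q with
  | zero =>
    simp only [Finset.univ_eq_empty, Finset.sum_empty] at h
    constructor
    · intro u
      ext x
      simpa [fwdDiff] using sub_eq_zero.mpr (add_right_cancel ((h (x + u) 0).symm.trans (h x 0)))
    · intro u
      ext x
      simpa [fwdDiff] using sub_eq_zero.mpr (add_left_cancel ((h 0 (x + u)).symm.trans (h 0 x)))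
  | succ n ih =>
    have key : ∀ u, FwdDiffVanish (n + 1) (Δ_[-A 0 u] P) ∧ FwdDiffVanish (n + 1) (Δ_[u] Q) := by
      intro u
      refine ih (fun i => A i.succ) (fun i => hA _)
        (fun i => Δ_[A i.succ u - A 0 u] (g i.succ)) _ _ fun x y => ?_
      have h1 := h (x + -A 0 u) (y + u)
      have h2 := h x y
      rw [Fin.sum_univ_succ] at h1 h2
      have h0 : x + -A 0 u + A 0 (y + u) = x + A 0 y := by rw [map_add]; abel
      have hs : ∀ i : Fin n, x + -A 0 u + A i.succ (y + u) =
          x + A i.succ y + (A i.succ u - A 0 u) := fun i => by rw [map_add]; abel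
      simp only [h0, hs] at h1
      simp only [fwdDiff, Finset.sum_sub_distrib]
      rw [eq_sub_of_add_eq' h1, eq_sub_of_add_eq' h2]
      abel
    refine ⟨fun u => ?_, fun u => (key u).2⟩
    obtain ⟨v, hv⟩ := hA 0 (-u)
    simpa [hv] using (key v).1

theorem stmt_16 {d m : ℕ} (hd : 0 < d) (hm : 0 < m)
    (b c : Fin m → Matrix (Fin d) (Fin d) ℝ)
    (hb : ∀ i, IsUnit (b i)) (hc : ∀ i, IsUnit (c i))
    (hij : ∀ i j, i ≠ j → IsUnit ((b i)⁻¹ * c i - (b j)⁻¹ * c j))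
    (f : Fin m → (Fin d → ℝ) → ℂ) (hf : ∀ i, Continuous (f i))
    (heq : ∀ x y : Fin d → ℝ,
      ∑ i, f i ((b i).mulVec x + (c i).mulVec y) =
        (∑ i, f i ((b i).mulVec x)) + ∑ i, f i ((c i).mulVec y)) :
    IsPolyFunOfDegLE (fun x => ∑ i, f i ((b i).mulVec x)) m ∧
      IsPolyFunOfDegLE (fun y => ∑ i, f i ((c i).mulVec y)) m := by
  have hE : ∀ x y : Fin d → ℝ,
      ∑ i, f i ((b i).mulVec (x + ((b i)⁻¹ * c i).mulVecLin.toAddMonoidHom y)) =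
        (∑ i, f i ((b i).mulVec x)) + ∑ i, f i ((c i).mulVec y) := fun x y => by
    rw [← heq]
    refine Finset.sum_congr rfl fun i _ => ?_
    have := (Matrix.isUnit_iff_isUnit_det _).mp (hb i)
    simp [Matrix.mulVec_add, Matrix.mul_nonsing_inv_cancel_left _ _ this]
  obtain ⟨hP, hQ⟩ := fwdDiffVanish_of_sum_eq
    (fun i => ((b i)⁻¹ * c i).mulVecLin.toAddMonoidHom)
    (fun i => Matrix.mulVec_surjective_iff_isUnit.mpr
      ((Matrix.isUnit_nonsing_inv_iff.mpr (hb i)).mul (hc i)))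
    (fun i z => f i ((b i).mulVec z)) _ _ hE
  exact ⟨hP.isPolyFunOfDegLE (by fun_prop), hQ.isPolyFunOfDegLE (by fun_prop)⟩
end
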